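/- arXiv:2205.07599 — 2 statements merged into one kernel-verified Lean document; each statement's English description precedes it below -/
import Mathlib

section
/- Let p > 1, 0 < α ≤ 1, 0 < β ≤ 1, and −1 < μ, ν < p−1. For every constant C < α^{−1/p} · β^{−1/p'} · B((1+μ)/p, (p−1−ν)/p), there exists a nonzero a ∈ l^p with ‖H̃^{μ,ν}_{p,α,β} a‖_p > C · ‖a‖_p; consequently the operator norm of H̃^{μ,ν}_{p,α,β} on l^p is at least α^{−1/p} · β^{−1/p'} · B((1+μ)/p, (p−1−ν)/p), where B denotes the Beta function. -/
open scoped ENNReal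

/-- The `l^p` norm of a sequence indexed from `n = 2` (entry `n` of the abstract
sequence corresponds to `a (n)`, and we sum over `n ≥ 2` via the shift `n + 2`). -/
noncomputable def lpNorm (p : ℝ) (a : ℕ → ℂ) : ℝ≥0∞ :=
  (∑' n : ℕ, (‖a (n + 2)‖₊ : ℝ≥0∞) ^ p) ^ (1 / p)

/-- The Beta function `B(u, v) = ∫_0^∞ t^{u-1} / (1+t)^{u+v} dt`. -/
noncomputable def betaFn (u v : ℝ) : ℝ :=
  ∫ t in Set.Ioi (0 : ℝ), t ^ (u - 1) / (1 + t) ^ (u + v)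

/-- The operator `H̃^{μ,ν}_{p,α,β}`, i.e. the generalized multiplicative Hilbert
operator with exponent `γ = 1 + (μ−ν)/p`; here `q = p'` is the conjugate exponent. -/
noncomputable def tildeH (p q α β μ ν : ℝ) (a : ℕ → ℂ) : ℕ → ℂ := fun m =>
  ((Real.log m ^ (((α - 1) + α * μ) / p) / (m : ℝ) ^ (1 / p) : ℝ) : ℂ) *
    ∑' n : ℕ,
      ((Real.log ((n : ℝ) + 2) ^ (((β - 1) - (q - 1) * β * ν) / q) /
          (((n : ℝ) + 2) ^ (1 / q) *
            (Real.log m ^ α + Real.log ((n : ℝ) + 2) ^ β) ^ (1 + (μ - ν) / p)) : ℝ) : ℂ) *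
        a (n + 2)

section Helpers

open MeasureTheory

lemma beta_integrand_cont (u v : ℝ) :
    ContinuousOn (fun t : ℝ => t ^ (u - 1) / (1 + t) ^ (u + v)) (Set.Ioi 0) := by
  intro t ht
  have ht' : (0:ℝ) < t := ht
  apply ContinuousAt.continuousWithinAt
  have h1 : (0:ℝ) < 1 + t := by linarith
  refine ContinuousAt.div ?_ ?_ (Real.rpow_pos_of_pos h1 _).ne'
  · exact Real.continuousAt_rpow_const _ _ (Or.inl ht'.ne')
  · exact ContinuousAt.rpow_const (by fun_prop) (Or.inl h1.ne')

lemma beta_integrand_pos (u v : ℝ) {t : ℝ} (ht : 0 < t) :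
    0 < t ^ (u - 1) / (1 + t) ^ (u + v) := by positivity

lemma beta_integrand_ii (u v : ℝ) {a b : ℝ} (ha : 0 < a) (hb : 0 < b) :
    IntervalIntegrable (fun t : ℝ => t ^ (u - 1) / (1 + t) ^ (u + v)) volume a b := by
  apply ContinuousOn.intervalIntegrable
  apply (beta_integrand_cont u v).mono
  intro x hx
  exact lt_of_lt_of_le (lt_min ha hb) hx.1

lemma exists_delta (u v K C : ℝ) (hK : 0 < K) (hC : C < K * betaFn u v) :
    ∃ δ : ℝ, 0 < δ ∧ δ < 1 ∧
      0 < (∫ t in δ..(1 / δ), t ^ (u - 1) / (1 + t) ^ (u + v)) ∧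
      C < K * ∫ t in δ..(1 / δ), t ^ (u - 1) / (1 + t) ^ (u + v) := by
  have hpos : ∀ δ : ℝ, 0 < δ → δ < 1 →
      0 < (∫ t in δ..(1 / δ), t ^ (u - 1) / (1 + t) ^ (u + v)) := by
    intro δ h0 h1
    have h2 : 1 < 1 / δ := by rw [lt_div_iff₀ h0]; linarith
    apply intervalIntegral.intervalIntegral_pos_of_pos_on
    · exact beta_integrand_ii u v h0 (by linarith)
    · intro x hx
      exact beta_integrand_pos u v (h0.trans hx.1)
    · linarith
  by_cases hI : IntegrableOn (fun t : ℝ => t ^ (u - 1) / (1 + t) ^ (u + v)) (Set.Ioi 0)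
  · set s : ℕ → Set ℝ := fun n => Set.Ioc (1 / ((n:ℝ) + 2)) ((n:ℝ) + 2) with hs
    have hU : (⋃ n, s n) = Set.Ioi 0 := by
      ext x
      simp only [hs, Set.mem_iUnion, Set.mem_Ioc, Set.mem_Ioi]
      constructor
      · rintro ⟨n, h, -⟩
        exact lt_trans (by positivity) h
      · intro hx
        obtain ⟨n, hn⟩ := exists_nat_gt (max x (1 / x))
        refine ⟨n, ?_, ?_⟩
        · have : 1 / x < (n:ℝ) + 2 := by
            have := le_max_right x (1/x)
            linarith
          rw [div_lt_iff₀ hx] at this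
          rw [div_lt_iff₀ (by positivity)]
          linarith
        · have := le_max_left x (1/x)
          linarith
    have hm : Monotone s := by
      intro a b hab
      have : (a:ℝ) ≤ b := by exact_mod_cast hab
      apply Set.Ioc_subset_Ioc
      · apply one_div_le_one_div_of_le
        · positivity
        · linarith
      · linarith
    have ht := tendsto_setIntegral_of_monotone (μ := volume)
      (f := fun t : ℝ => t ^ (u - 1) / (1 + t) ^ (u + v)) (s := s)
      (fun i => measurableSet_Ioc) hm (by rw [hU]; exact hI)
    rw [hU] at ht
    have ht2 := ht.const_mul K
    obtain ⟨n, hn⟩ := (ht2.eventually_const_lt (u := C) hC).exists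
    have hδ0 : (0:ℝ) < 1 / ((n:ℝ) + 2) := by positivity
    have hn0 : (0:ℝ) ≤ n := by positivity
    have hδ1 : (1:ℝ) / ((n:ℝ) + 2) < 1 := by
      rw [div_lt_one (by positivity)]; linarith
    refine ⟨1 / ((n:ℝ) + 2), hδ0, hδ1, hpos _ hδ0 hδ1, ?_⟩
    rw [one_div_one_div, intervalIntegral.integral_of_le (by linarith)]
    exact hn
  · have : betaFn u v = 0 := integral_undef hI
    rw [this, mul_zero] at hC
    refine ⟨1/2, by norm_num, by norm_num, hpos _ (by norm_num) (by norm_num), ?_⟩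
    exact hC.trans (mul_pos hK (hpos _ (by norm_num) (by norm_num)))

lemma loglog_step (m : ℕ) (hm : 2 ≤ m) :
    Real.log (Real.log ((m:ℝ) + 1)) - Real.log (Real.log m) ≤ 1 / (m * Real.log m) ∧
    1 / (((m:ℝ) + 1) * Real.log ((m:ℝ) + 1)) ≤
      Real.log (Real.log ((m:ℝ) + 1)) - Real.log (Real.log m) := by
  have hm2 : (2:ℝ) ≤ m := by exact_mod_cast hm
  have ha : 0 < Real.log m := Real.log_pos (by linarith)
  have hb : 0 < Real.log ((m:ℝ) + 1) := Real.log_pos (by linarith)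
  have hm0 : (0:ℝ) < m := by linarith
  have e1 : Real.log ((m:ℝ) + 1) - Real.log m ≤ 1 / m := by
    rw [← Real.log_div (by positivity) (by positivity)]
    have := Real.log_le_sub_one_of_pos (x := ((m:ℝ) + 1) / m) (by positivity)
    have h2 : ((m:ℝ) + 1) / m - 1 = 1 / m := by field_simp; ring
    linarith
  have e2 : 1 / ((m:ℝ) + 1) ≤ Real.log ((m:ℝ) + 1) - Real.log m := by
    rw [← Real.log_div (by positivity) (by positivity)]
    have := Real.one_sub_inv_le_log_of_pos (x := ((m:ℝ) + 1) / m) (by positivity)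
    have h2 : 1 - (((m:ℝ) + 1) / m)⁻¹ = 1 / ((m:ℝ) + 1) := by field_simp; ring
    linarith
  rw [← Real.log_div hb.ne' ha.ne']
  constructor
  · have := Real.log_le_sub_one_of_pos (div_pos hb ha)
    refine this.trans ?_
    rw [div_sub_one ha.ne', ← div_div]
    gcongr
  · have := Real.one_sub_inv_le_log_of_pos (div_pos hb ha)
    refine le_trans ?_ this
    rw [inv_div, one_sub_div hb.ne', ← div_div]
    gcongr

lemma sum_upper (k : ℕ) :
    ∑ i ∈ Finset.range (k + 1), 1 / (((i:ℝ) + 2) * Real.log ((i:ℝ) + 2)) ≤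
      1 / (2 * Real.log 2) - Real.log (Real.log 2) + Real.log (Real.log ((k:ℝ) + 2)) := by
  induction k with
  | zero => simp
  | succ k ih =>
    rw [Finset.sum_range_succ]
    have := (loglog_step (k + 2) (by omega)).2
    push_cast at *
    have e : (k:ℝ) + 2 + 1 = k + 1 + 2 := by ring
    rw [e] at this
    linarith

lemma loglog_mono {a b : ℝ} (ha : 1 < a) (hab : a ≤ b) :
    Real.log (Real.log a) ≤ Real.log (Real.log b) :=
  Real.log_le_log (Real.log_pos ha) (Real.log_le_log (by linarith) hab)

lemma sum_lower (a b : ℕ) :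
    Real.log (Real.log ((b:ℝ) + 2)) - Real.log (Real.log ((a:ℝ) + 2)) ≤
    ∑ i ∈ Finset.Ico a b, 1 / (((i:ℝ) + 2) * Real.log ((i:ℝ) + 2)) := by
  rcases le_total b a with h | h
  · rw [Finset.Ico_eq_empty (by omega), Finset.sum_empty]
    have hb : (0:ℝ) ≤ b := by positivity
    have h' : (b:ℝ) ≤ a := by exact_mod_cast h
    have := loglog_mono (a := (b:ℝ) + 2) (b := (a:ℝ) + 2) (by linarith) (by linarith)
    linarith
  · induction b, h using Nat.le_induction with
    | base => simp
    | succ k hk ih =>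
      rw [Finset.sum_Ico_succ_top hk]
      have := (loglog_step (k + 2) (by omega)).1
      push_cast at *
      have e : (k:ℝ) + 2 + 1 = k + 1 + 2 := by ring
      rw [e] at this
      linarith

lemma inner_bound (u v β M δ : ℝ) (k : ℕ) (hu : 0 < u) (hv : 0 < v) (hβ : 0 < β)
    (hβv : β * v ≤ 1) (hM : 0 < M) (hδ : 0 < δ) (hδ1 : δ < 1)
    (h1 : M / Real.log ((k:ℝ) + 2) ^ β ≤ δ) (h2 : 1 / δ ≤ M / Real.log 2 ^ β) :
    M ^ (-u) / β * (∫ t in δ..(1 / δ), t ^ (u - 1) / (1 + t) ^ (u + v)) ≤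
    ∑ i ∈ Finset.range k, (((i:ℝ) + 2)⁻¹ * Real.log ((i:ℝ) + 2) ^ (β * v - 1) *
      (M + Real.log ((i:ℝ) + 2) ^ β) ^ (-(u + v))) := by
  set g : ℝ → ℝ := fun x => x⁻¹ * Real.log x ^ (β * v - 1) *
    (M + Real.log x ^ β) ^ (-(u + v)) with hg
  have hk2 : (2:ℝ) ≤ 2 + k := by
    have : (0:ℝ) ≤ k := by positivity
    linarith
  have hanti : AntitoneOn g (Set.Icc 2 (2 + (k:ℝ))) := by
    intro x hx y hy hxy
    have hx2 : (2:ℝ) ≤ x := hx.1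
    have hlx : 0 < Real.log x := Real.log_pos (by linarith)
    have hl : Real.log x ≤ Real.log y := Real.log_le_log (by linarith) hxy
    have hly : 0 < Real.log y := hlx.trans_le hl
    have hy0 : 0 < y := by linarith
    have hx0 : 0 < x := by linarith
    simp only [hg]
    have A : y⁻¹ ≤ x⁻¹ := inv_anti₀ hx0 hxy
    have B : Real.log y ^ (β * v - 1) ≤ Real.log x ^ (β * v - 1) :=
      Real.rpow_le_rpow_of_nonpos hlx hl (by linarith)
    have C : (M + Real.log y ^ β) ^ (-(u + v)) ≤ (M + Real.log x ^ β) ^ (-(u + v)) := by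
      apply Real.rpow_le_rpow_of_nonpos (by positivity) _ (by linarith)
      gcongr
    gcongr
  have hint := hanti.integral_le_sum
  have hsum : ∑ i ∈ Finset.range k, g (2 + (i:ℝ)) = ∑ i ∈ Finset.range k,
      (((i:ℝ) + 2)⁻¹ * Real.log ((i:ℝ) + 2) ^ (β * v - 1) *
      (M + Real.log ((i:ℝ) + 2) ^ β) ^ (-(u + v))) := by
    apply Finset.sum_congr rfl
    intro i _
    simp only [hg, add_comm (2:ℝ)]
  rw [hsum] at hint
  refine le_trans ?_ hint
  set φ : ℝ → ℝ := fun x => M * Real.log x ^ (-β) with hφ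
  set φ' : ℝ → ℝ := fun x => M * (x⁻¹ * (-β) * Real.log x ^ (-β - 1)) with hφ'
  have hder : ∀ x : ℝ, 2 ≤ x → HasDerivAt φ (φ' x) x := by
    intro x hx
    have hlx : 0 < Real.log x := Real.log_pos (by linarith)
    exact ((Real.hasDerivAt_log (by linarith : x ≠ 0)).rpow_const (Or.inl hlx.ne')).const_mul M
  have hmem : ∀ x ∈ Set.uIcc (2:ℝ) (2 + k), 2 ≤ x := by
    intro x hx
    rw [Set.uIcc_of_le hk2] at hx
    exact hx.1
  have hsub := intervalIntegral.integral_comp_mul_deriv'' (a := 2) (b := 2 + (k:ℝ))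
    (f := φ) (f' := φ') (g := fun t : ℝ => t ^ (u - 1) / (1 + t) ^ (u + v))
    (fun x hx => (hder x (hmem x hx)).continuousAt.continuousWithinAt)
    (fun x hx => (hder x (by
      rw [min_eq_left hk2] at hx; exact hx.1.le)).hasDerivWithinAt)
    (by
      intro x hx
      have hx2 := hmem x hx
      have hlx : 0 < Real.log x := Real.log_pos (by linarith)
      have hx0 : x ≠ 0 := by linarith
      apply ContinuousAt.continuousWithinAt
      refine ContinuousAt.mul continuousAt_const (ContinuousAt.mul ?_ ?_)
      · exact (continuousAt_inv₀ hx0).mul continuousAt_const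
      · exact (Real.continuousAt_log hx0).rpow_const (Or.inl hlx.ne'))
    ((beta_integrand_cont u v).mono (by
      rintro _ ⟨x, hx, rfl⟩
      have hx2 := hmem x hx
      have hlx : 0 < Real.log x := Real.log_pos (by linarith)
      show 0 < M * Real.log x ^ (-β)
      positivity))
  have hcongr : ∫ x in (2:ℝ)..(2 + k), ((fun t : ℝ => t ^ (u - 1) / (1 + t) ^ (u + v)) ∘ φ) x * φ' x
      = ∫ x in (2:ℝ)..(2 + k), (-(β * M ^ u)) * g x := by
    apply intervalIntegral.integral_congr
    intro x hx
    have hx2 := hmem x hx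
    have hx0 : 0 < x := by linarith
    have hlx : 0 < Real.log x := Real.log_pos (by linarith)
    simp only [Function.comp, hφ, hφ', hg]
    set l := Real.log x
    have e1 : 1 + M * l ^ (-β) = (M + l ^ β) * l ^ (-β) := by
      rw [add_mul, ← Real.rpow_add hlx]; simp [add_comm]
    rw [e1, Real.mul_rpow hM.le (by positivity), Real.mul_rpow (by positivity) (by positivity),
      ← Real.rpow_mul hlx.le, ← Real.rpow_mul hlx.le, Real.rpow_neg (by positivity) (u + v)]
    have e2 : M ^ u = M ^ (u - 1) * M := by
      rw [← Real.rpow_add_one hM.ne']; simp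
    have e3 : l ^ (β * v - 1) * l ^ (-β * (u + v)) = l ^ (-β * (u - 1)) * l ^ (-β - 1) := by
      rw [← Real.rpow_add hlx, ← Real.rpow_add hlx]; ring_nf
    have p1 : 0 < l ^ (-β * (u + v)) := by positivity
    have p2 : 0 < (M + l ^ β) ^ (u + v) := by positivity
    rw [e2]
    generalize l ^ (-β * (u + v)) = X1 at *
    generalize l ^ (-β * (u - 1)) = X2 at *
    generalize l ^ (β * v - 1) = X3 at *
    generalize l ^ (-β - 1) = X4 at *
    generalize (M + l ^ β) ^ (u + v) = X5 at *
    field_simp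
    linear_combination e3
  rw [hcongr, intervalIntegral.integral_const_mul, intervalIntegral.integral_symm (φ (2 + k))] at hsub
  have hlk : 0 < Real.log (2 + (k:ℝ)) := Real.log_pos (by linarith)
  have hl2 : 0 < Real.log 2 := Real.log_pos (by norm_num)
  have q1 : φ (2 + k) ≤ δ := by
    simp only [hφ]
    rw [Real.rpow_neg hlk.le, ← div_eq_mul_inv, add_comm]; exact h1
  have q2 : 1 / δ ≤ φ 2 := by
    simp only [hφ]
    rw [Real.rpow_neg hl2.le, ← div_eq_mul_inv]; exact h2
  have q0 : 0 < φ (2 + k) := by simp only [hφ]; positivity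
  have q3 : δ ≤ 1 / δ := by rw [le_div_iff₀ hδ]; nlinarith
  have hmono := intervalIntegral.integral_mono_interval (μ := volume)
    (f := fun t : ℝ => t ^ (u - 1) / (1 + t) ^ (u + v)) q1 q3 q2
    (by
      refine (ae_restrict_iff' measurableSet_Ioc).2 (Filter.Eventually.of_forall ?_)
      intro x hx
      exact (beta_integrand_pos u v (q0.trans hx.1)).le)
    (beta_integrand_ii u v q0 (by linarith))
  have hMu : M ^ (-u) * M ^ u = 1 := by rw [← Real.rpow_add hM]; simp
  have hfin : ∫ x in (2:ℝ)..(2 + k), g x =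
      M ^ (-u) / β * ∫ t in φ (2 + k)..φ 2, t ^ (u - 1) / (1 + t) ^ (u + v) := by
    have : ∫ t in φ (2 + k)..φ 2, t ^ (u - 1) / (1 + t) ^ (u + v) =
      β * M ^ u * ∫ x in (2:ℝ)..(2 + k), g x := by linarith
    rw [this]
    rw [div_mul_eq_mul_div, eq_div_iff hβ.ne']
    linear_combination (-β * ∫ x in (2:ℝ)..(2 + k), g x) * hMu
  rw [hfin]
  gcongr
lemma nn_eq (z : ℂ) : (‖z‖₊ : ℝ≥0∞) = ENNReal.ofReal ‖z‖ := by
  rw [← coe_nnnorm, ENNReal.ofReal_coe_nnreal]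


/-- The truncated extremal sequence. -/
noncomputable def testSeq (p : ℝ) (k : ℕ) : ℕ → ℂ := fun n =>
  if n < k + 2 then (((n:ℝ) ^ (-(1 / p)) * Real.log n ^ (-(1 / p)) : ℝ) : ℂ) else 0

lemma pow_aux (p : ℝ) (hp : 1 < p) (i : ℕ) :
    0 < Real.log ((i:ℝ) + 2) ∧
    (((i:ℝ) + 2) ^ (-(1 / p)) * Real.log ((i:ℝ) + 2) ^ (-(1 / p))) ^ p =
      1 / (((i:ℝ) + 2) * Real.log ((i:ℝ) + 2)) := by
  have hi : (0:ℝ) ≤ i := by positivity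
  have hl : 0 < Real.log ((i:ℝ) + 2) := Real.log_pos (by linarith)
  have hp0 : p ≠ 0 := by linarith
  refine ⟨hl, ?_⟩
  rw [← Real.mul_rpow (by positivity) hl.le, ← Real.rpow_mul (by positivity)]
  have : -(1 / p) * p = -1 := by field_simp
  rw [this, Real.rpow_neg_one, one_div]

lemma lpNorm_testSeq (p : ℝ) (hp : 1 < p) (k : ℕ) :
    lpNorm p (testSeq p k) = (ENNReal.ofReal
      (∑ i ∈ Finset.range k, 1 / (((i:ℝ) + 2) * Real.log ((i:ℝ) + 2)))) ^ (1 / p) := by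
  unfold _root_.lpNorm
  congr 1
  rw [tsum_eq_sum (s := Finset.range k)]
  · rw [ENNReal.ofReal_sum_of_nonneg]
    · apply Finset.sum_congr rfl
      intro i hi
      have hi' : i + 2 < k + 2 := by have := Finset.mem_range.1 hi; omega
      obtain ⟨hl, he⟩ := pow_aux p hp i
      rw [← he, ← ENNReal.ofReal_rpow_of_nonneg (by positivity) (by linarith)]
      congr 1
      rw [nn_eq]
      simp only [testSeq, if_pos hi']
      rw [Complex.norm_real, Real.norm_of_nonneg]
      · push_cast; rfl
      · push_cast; positivity
    · intro i _
      obtain ⟨hl, he⟩ := pow_aux p hp i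
      positivity
  · intro i hi
    have hi' : ¬ (i + 2 < k + 2) := by
      intro h; exact hi (Finset.mem_range.2 (by omega))
    have hp0 : 0 < p := by linarith
    simp [testSeq, hi', hp0]

lemma tildeH_testSeq (p q α β μ ν : ℝ) (hp : 1 < p) (hq : 1 / p + 1 / q = 1) (k j : ℕ) :
    tildeH p q α β μ ν (testSeq p k) (j + 2) =
      (((Real.log ((j:ℝ) + 2) ^ (((α - 1) + α * μ) / p) / ((j:ℝ) + 2) ^ (1 / p)) *
      ∑ i ∈ Finset.range k, (((i:ℝ) + 2)⁻¹ * Real.log ((i:ℝ) + 2) ^ (β * ((p - 1 - ν) / p) - 1) *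
      (Real.log ((j:ℝ) + 2) ^ α + Real.log ((i:ℝ) + 2) ^ β) ^
        (-((1 + μ) / p + (p - 1 - ν) / p))) : ℝ) : ℂ) := by
  have hp0 : 0 < p := by linarith
  have hq1 : 1 / q = 1 - 1 / p := by linarith
  have hqp : 0 < 1 / q := by
    rw [hq1, sub_pos, div_lt_one hp0]; exact hp
  have hq0 : 0 < q := by simpa using hqp
  unfold tildeH
  rw [Complex.ofReal_mul, Complex.ofReal_sum]
  congr 1
  · push_cast; rfl
  rw [tsum_eq_sum (s := Finset.range k)]
  · apply Finset.sum_congr rfl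
    intro i hi
    have hi' : i + 2 < k + 2 := by have := Finset.mem_range.1 hi; omega
    obtain ⟨hl, -⟩ := pow_aux p hp i
    obtain ⟨hlj, -⟩ := pow_aux p hp j
    simp only [testSeq, if_pos hi']
    rw [← Complex.ofReal_mul]
    congr 1
    push_cast
    have hn : (0:ℝ) < (i:ℝ) + 2 := by positivity
    have hD : 0 < Real.log ((j:ℝ) + 2) ^ α + Real.log ((i:ℝ) + 2) ^ β := by positivity
    have e1 : (1 + μ) / p + (p - 1 - ν) / p = 1 + (μ - ν) / p := by field_simp; ring
    have e2 : β * ((p - 1 - ν) / p) - 1 = (β - 1 - (q - 1) * β * ν) / q + -(1 / p) := by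
      have a1 : (β - 1 - (q - 1) * β * ν) / q = (β - 1) * (1 / q) - (1 - 1 / q) * β * ν := by
        field_simp
      rw [a1, hq1]
      field_simp
      ring
    have e3 : ((i:ℝ) + 2)⁻¹ = (((i:ℝ) + 2) ^ (1 / q))⁻¹ * ((i:ℝ) + 2) ^ (-(1 / p)) := by
      rw [← Real.rpow_neg hn.le, ← Real.rpow_add hn, ← Real.rpow_neg_one]
      congr 1; linarith
    rw [e1, e2, e3, Real.rpow_add hl, Real.rpow_neg hD.le]
    rw [div_eq_mul_inv, mul_inv]
    ring
  · intro i hi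
    have hi' : ¬ (i + 2 < k + 2) := by
      intro h; exact hi (Finset.mem_range.2 (by omega))
    simp [testSeq, hi']

lemma tildeH_lower (p q α β μ ν δ : ℝ) (hp : 1 < p) (hq : 1 / p + 1 / q = 1)
    (hα0 : 0 < α) (hβ0 : 0 < β) (hβ1 : β ≤ 1)
    (hμ1 : -1 < μ) (hν1 : -1 < ν) (hν2 : ν < p - 1) (hδ : 0 < δ) (hδ1 : δ < 1) (k j : ℕ)
    (hB : 0 < ∫ t in δ..(1 / δ), t ^ ((1 + μ) / p - 1) / (1 + t) ^ ((1 + μ) / p + (p - 1 - ν) / p))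
    (h1 : Real.log ((j:ℝ) + 2) ^ α ≤ δ * Real.log ((k:ℝ) + 2) ^ β)
    (h2 : Real.log 2 ^ β ≤ δ * Real.log ((j:ℝ) + 2) ^ α) :
    ENNReal.ofReal (((∫ t in δ..(1 / δ),
        t ^ ((1 + μ) / p - 1) / (1 + t) ^ ((1 + μ) / p + (p - 1 - ν) / p)) / β) ^ p *
        (1 / (((j:ℝ) + 2) * Real.log ((j:ℝ) + 2)))) ≤
      (‖tildeH p q α β μ ν (testSeq p k) (j + 2)‖₊ : ℝ≥0∞) ^ p := by
  have hp0 : 0 < p := by linarith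
  obtain ⟨hlj, hej⟩ := pow_aux p hp j
  obtain ⟨hlk, -⟩ := pow_aux p hp k
  have hl2 : 0 < Real.log 2 := Real.log_pos (by norm_num)
  have hu : 0 < (1 + μ) / p := div_pos (by linarith) hp0
  have hv : 0 < (p - 1 - ν) / p := div_pos (by linarith) hp0
  have hv1 : (p - 1 - ν) / p ≤ 1 := by rw [div_le_one hp0]; linarith
  have hM : 0 < Real.log ((j:ℝ) + 2) ^ α := by positivity
  have hin := inner_bound ((1 + μ) / p) ((p - 1 - ν) / p) β (Real.log ((j:ℝ) + 2) ^ α) δ k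
    hu hv hβ0 (by nlinarith) hM hδ hδ1
    (by rw [div_le_iff₀ (by positivity)]; exact h1)
    (by rw [div_le_div_iff₀ hδ (by positivity)]; linarith)
  rw [tildeH_testSeq p q α β μ ν hp hq k j]
  set Bd := ∫ t in δ..(1 / δ),
        t ^ ((1 + μ) / p - 1) / (1 + t) ^ ((1 + μ) / p + (p - 1 - ν) / p)
  set S := ∑ i ∈ Finset.range k, (((i:ℝ) + 2)⁻¹ * Real.log ((i:ℝ) + 2) ^ (β * ((p - 1 - ν) / p) - 1) *
      (Real.log ((j:ℝ) + 2) ^ α + Real.log ((i:ℝ) + 2) ^ β) ^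
        (-((1 + μ) / p + (p - 1 - ν) / p)))
  rw [← hej, ← Real.mul_rpow (by positivity) (by positivity),
    ← ENNReal.ofReal_rpow_of_nonneg (by positivity) hp0.le]
  apply ENNReal.rpow_le_rpow _ hp0.le
  rw [nn_eq, Complex.norm_real]
  apply ENNReal.ofReal_le_ofReal
  refine le_trans ?_ (le_abs_self _)
  have hw : Real.log ((j:ℝ) + 2) ^ (((α - 1) + α * μ) / p) / ((j:ℝ) + 2) ^ (1 / p) *
      (Real.log ((j:ℝ) + 2) ^ α) ^ (-((1 + μ) / p)) =
      ((j:ℝ) + 2) ^ (-(1 / p)) * Real.log ((j:ℝ) + 2) ^ (-(1 / p)) := by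
    have e : -(1 / p) = ((α - 1) + α * μ) / p + α * (-((1 + μ) / p)) := by field_simp; ring
    rw [← Real.rpow_mul hlj.le, Real.rpow_neg (by positivity : (0:ℝ) ≤ (j:ℝ) + 2), e,
      Real.rpow_add hlj]
    ring
  rw [← hw]
  refine le_trans (le_of_eq ?_) (mul_le_mul_of_nonneg_left hin (by positivity))
  ring

lemma first_part
    (p q α β μ ν : ℝ) (hp : 1 < p) (hq : 1 / p + 1 / q = 1)
    (hα0 : 0 < α) (hβ0 : 0 < β) (hβ1 : β ≤ 1)
    (hμ1 : -1 < μ) (hν1 : -1 < ν) (hν2 : ν < p - 1) (C : ℝ)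
    (hC : C < α ^ (-(1 / p)) * β ^ (-(1 / q)) * betaFn ((1 + μ) / p) ((p - 1 - ν) / p)) :
      ∃ a : ℕ → ℂ, lpNorm p a ≠ 0 ∧ lpNorm p a ≠ ⊤ ∧
        ENNReal.ofReal C * lpNorm p a < lpNorm p (tildeH p q α β μ ν a) := by
  have hp0 : 0 < p := by linarith
  have hq1 : 1 / q = 1 - 1 / p := by linarith
  obtain ⟨δ, hδ, hδ1, hB, hCB⟩ := exists_delta _ _ _ C (by positivity) hC
  have hlow := fun k j => tildeH_lower p q α β μ ν δ hp hq hα0 hβ0 hβ1 hμ1 hν1 hν2 hδ hδ1 k j hB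
  set Bd := ∫ t in δ..(1 / δ),
        t ^ ((1 + μ) / p - 1) / (1 + t) ^ ((1 + μ) / p + (p - 1 - ν) / p) with hBd
  clear_value Bd
  set c := max C 0 with hc
  have hc0 : 0 ≤ c := le_max_right _ _
  have hcB : c < α ^ (-(1 / p)) * β ^ (-(1 / q)) * Bd := max_lt hCB (by positivity)
  have hcp : c ^ p < (Bd / β) ^ p * (β / α) := by
    have := Real.rpow_lt_rpow hc0 hcB hp0
    refine this.trans_eq ?_
    rw [Real.mul_rpow (by positivity) hB.le, Real.mul_rpow (by positivity) (by positivity),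
      ← Real.rpow_mul hα0.le, ← Real.rpow_mul hβ0.le, Real.div_rpow hB.le hβ0.le]
    have e1 : -(1 / p) * p = -1 := by field_simp
    have e2 : -(1 / q) * p = 1 - p := by rw [hq1]; field_simp; ring
    rw [e1, e2, Real.rpow_neg_one, Real.rpow_sub hβ0, Real.rpow_one]
    field_simp
  set P := (Bd / β) ^ p with hP
  have hP0 : 0 < P := by positivity
  -- the starting index
  have hl2 : 0 < Real.log 2 := Real.log_pos (by norm_num)
  have hnat : Filter.Tendsto (fun n : ℕ => Real.log ((n:ℝ) + 2)) Filter.atTop Filter.atTop :=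
    Real.tendsto_log_atTop.comp
      (Filter.tendsto_atTop_add_const_right _ _ tendsto_natCast_atTop_atTop)
  obtain ⟨j0, hj0⟩ := (((tendsto_rpow_atTop hα0).comp hnat).eventually_ge_atTop
    (Real.log 2 ^ β / δ)).exists
  simp only [Function.comp] at hj0
  rw [div_le_iff₀ hδ] at hj0
  set d := Real.log (Real.log ((j0:ℝ) + 2)) with hd
  set c2 := 1 / (2 * Real.log 2) - Real.log (Real.log 2) with hc2
  obtain ⟨k', hk'⟩ := ((Real.tendsto_log_atTop.comp hnat).eventually_gt_atTop
    ((c ^ p * c2 + P * (d - Real.log δ / α)) / (P * (β / α) - c ^ p))).exists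
  simp only [Function.comp] at hk'
  rw [div_lt_iff₀ (by linarith)] at hk'
  set k := k' + 1 with hk
  set S := ∑ i ∈ Finset.range k, 1 / (((i:ℝ) + 2) * Real.log ((i:ℝ) + 2)) with hS
  have hSle : S ≤ c2 + Real.log (Real.log ((k':ℝ) + 2)) := sum_upper k'
  have hS0 : 0 < S := by
    apply Finset.sum_pos
    · intro i _
      obtain ⟨hl, -⟩ := pow_aux p hp i
      positivity
    · exact ⟨0, by simp [hk]⟩
  have hlk' := (pow_aux p hp k').1
  have hlk := (pow_aux p hp k).1
  have hLL : Real.log ((k':ℝ) + 2) ≤ Real.log ((k:ℝ) + 2) := by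
    apply Real.log_le_log (by positivity)
    rw [hk]; push_cast; linarith
  set y := (δ * Real.log ((k':ℝ) + 2) ^ β) ^ (1 / α) with hy
  have hy0 : 0 < y := by positivity
  have hyα : y ^ α = δ * Real.log ((k':ℝ) + 2) ^ β := by
    rw [hy, ← Real.rpow_mul (by positivity)]
    have : 1 / α * α = 1 := by field_simp
    rw [this, Real.rpow_one]
  have hlogy : Real.log y = Real.log δ / α + (β / α) * Real.log (Real.log ((k':ℝ) + 2)) := by
    rw [hy, Real.log_rpow (by positivity), Real.log_mul hδ.ne' (by positivity),
      Real.log_rpow hlk']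
    ring
  set j1 := ⌊Real.exp y⌋₊ - 1 with hj1
  have hj1y : y ≤ Real.log ((j1:ℝ) + 2) := by
    rw [Real.le_log_iff_exp_le (by positivity)]
    have h1 := Nat.lt_floor_add_one (Real.exp y)
    have h2 : ⌊Real.exp y⌋₊ + 1 ≤ j1 + 2 := by omega
    have h3 : ((⌊Real.exp y⌋₊:ℝ) + 1) ≤ j1 + 2 := by exact_mod_cast h2
    linarith
  have hlowsum := sum_lower j0 j1
  have hll : Real.log y ≤ Real.log (Real.log ((j1:ℝ) + 2)) := Real.log_le_log hy0 hj1y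
  set R := ∑ i ∈ Finset.Ico j0 j1, 1 / (((i:ℝ) + 2) * Real.log ((i:ℝ) + 2)) with hR
  have hkey : c ^ p * S < P * R := by
    have h1 : c ^ p * S ≤ c ^ p * (c2 + Real.log (Real.log ((k':ℝ) + 2))) := by gcongr
    have h2 : P * (Real.log δ / α + (β / α) * Real.log (Real.log ((k':ℝ) + 2)) - d) ≤ P * R := by
      apply mul_le_mul_of_nonneg_left _ hP0.le
      linarith
    refine h1.trans_lt (lt_of_lt_of_le ?_ h2)
    linarith
  have hX : ENNReal.ofReal (P * R) ≤
      ∑' j : ℕ, (‖tildeH p q α β μ ν (testSeq p k) (j + 2)‖₊ : ℝ≥0∞) ^ p := by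
    refine le_trans ?_ (ENNReal.sum_le_tsum (Finset.Ico j0 j1))
    rw [hR, Finset.mul_sum, ENNReal.ofReal_sum_of_nonneg]
    · apply Finset.sum_le_sum
      intro j hj
      rw [Finset.mem_Ico] at hj
      have hlj := (pow_aux p hp j).1
      apply hlow k j
      · have hfl : ((j:ℝ) + 2) ≤ Real.exp y := by
          have h2 : j + 2 ≤ ⌊Real.exp y⌋₊ := by omega
          have h3 := Nat.floor_le (Real.exp_pos y).le
          have h4 : ((j:ℝ) + 2) ≤ (⌊Real.exp y⌋₊ : ℝ) := by exact_mod_cast h2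
          linarith
        have h5 : Real.log ((j:ℝ) + 2) ≤ y := by
          rw [Real.log_le_iff_le_exp (by positivity)]; exact hfl
        calc Real.log ((j:ℝ) + 2) ^ α ≤ y ^ α := by gcongr
          _ = δ * Real.log ((k':ℝ) + 2) ^ β := hyα
          _ ≤ _ := by gcongr
      · have hjj : (j0:ℝ) ≤ j := by exact_mod_cast hj.1
        have hlj0 := (pow_aux p hp j0).1
        calc Real.log 2 ^ β ≤ Real.log ((j0:ℝ) + 2) ^ α * δ := hj0
          _ ≤ Real.log ((j:ℝ) + 2) ^ α * δ := by gcongr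
          _ = _ := by ring
    · intro j _
      obtain ⟨hl, -⟩ := pow_aux p hp j
      positivity
  refine ⟨testSeq p k, ?_, ?_, ?_⟩
  · rw [lpNorm_testSeq p hp]
    apply (ENNReal.rpow_pos (ENNReal.ofReal_pos.2 hS0) ENNReal.ofReal_ne_top).ne'
  · rw [lpNorm_testSeq p hp]
    exact ENNReal.rpow_ne_top_of_nonneg (by positivity) ENNReal.ofReal_ne_top
  · rw [lpNorm_testSeq p hp]
    have hCc : ENNReal.ofReal C ≤ (ENNReal.ofReal (c ^ p)) ^ (1 / p) := by
      rw [ENNReal.ofReal_rpow_of_nonneg (by positivity) (by positivity),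
        ← Real.rpow_mul hc0, mul_one_div_cancel hp0.ne', Real.rpow_one]
      exact ENNReal.ofReal_le_ofReal (le_max_left _ _)
    refine (mul_le_mul_left hCc _).trans_lt ?_
    rw [← ENNReal.mul_rpow_of_nonneg _ _ (by positivity), ← ENNReal.ofReal_mul (by positivity)]
    unfold _root_.lpNorm
    apply ENNReal.rpow_lt_rpow _ (by positivity)
    refine lt_of_lt_of_le ?_ hX
    exact (ENNReal.ofReal_lt_ofReal_iff_of_nonneg (by positivity)).2 hkey

end Helpers

/-- **(Lower bound in Theorem 1.3.)** For every constant
`C < α^{-1/p} β^{-1/p'} B((1+μ)/p, (p−1−ν)/p)` there is a nonzero `a ∈ l^p` with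
`‖H̃ a‖_p > C ‖a‖_p`; consequently the operator norm of `H̃^{μ,ν}_{p,α,β}` on `l^p`
is at least `α^{-1/p} β^{-1/p'} B((1+μ)/p, (p−1−ν)/p)`. -/
theorem tilde_generalized_multiplicative_hilbert_norm_ge
    (p q α β μ ν : ℝ) (hp : 1 < p) (hq : 1 / p + 1 / q = 1)
    (hα0 : 0 < α) (hα1 : α ≤ 1) (hβ0 : 0 < β) (hβ1 : β ≤ 1)
    (hμ1 : -1 < μ) (hμ2 : μ < p - 1) (hν1 : -1 < ν) (hν2 : ν < p - 1) :
    (∀ C : ℝ,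
      C < α ^ (-(1 / p)) * β ^ (-(1 / q)) * betaFn ((1 + μ) / p) ((p - 1 - ν) / p) →
      ∃ a : ℕ → ℂ, lpNorm p a ≠ 0 ∧ lpNorm p a ≠ ⊤ ∧
        ENNReal.ofReal C * lpNorm p a < lpNorm p (tildeH p q α β μ ν a)) ∧
    ∀ C : ℝ≥0∞,
      (∀ a : ℕ → ℂ, lpNorm p a ≠ ⊤ →
        lpNorm p (tildeH p q α β μ ν a) ≤ C * lpNorm p a) →
      ENNReal.ofReal
          (α ^ (-(1 / p)) * β ^ (-(1 / q)) * betaFn ((1 + μ) / p) ((p - 1 - ν) / p))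
        ≤ C := by
  have H := first_part p q α β μ ν hp hq hα0 hβ0 hβ1 hμ1 hν1 hν2
  refine ⟨H, ?_⟩
  intro C hC
  by_contra hlt
  rw [not_le] at hlt
  have hCt : C ≠ ⊤ := (hlt.trans_le le_top).ne
  have h1 := (ENNReal.lt_ofReal_iff_toReal_lt hCt).1 hlt
  obtain ⟨a, -, ha, hlt2⟩ := H C.toReal h1
  rw [ENNReal.ofReal_toReal hCt] at hlt2
  exact absurd (hC a ha) (not_le.2 hlt2)
end

section
/- Let p > 1, γ > 0, −1 < μ, ν < p−1, and let λ be a positive Borel measure on [0,1). If the measure τ with dτ(t) = (1−t)^{γ−1} dλ(t) is a [1+(μ−ν)/p]-Carleson measure (i.e., there exists C > 0 with τ([t,1)) ≤ C(1−t)^{1+(μ−ν)/p} for all t ∈ [0,1)), then the operator Ĥ^{μ,ν}_{p,γ,λ}, defined for a = {a_n}_{n≥2} ∈ l^p by Ĥ^{μ,ν}_{p,γ,λ}(a)(m) = (log m)^{μ/p} / m^{1/p} · Σ_{n=2}^∞ (log n)^{−ν/p} / n^{1/p'} · λ[mn] · a_n for m ≥ 2, where λ[k] = ∫_{[0,1)}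 t^{(log k)−1} (1−t)^{γ−1} dλ(t), is bounded on l^p. -/
open scoped ENNReal
open MeasureTheory

/-- The moment `lam[k] = ∫_{[0,1)} t^{(log k)−1} (1−t)^{γ−1} dlam(t)`. -/
noncomputable def lamMoment (γ : ℝ) (lam : Measure ℝ) (k : ℝ) : ℝ≥0∞ :=
  ∫⁻ t in Set.Ico (0 : ℝ) 1,
    ENNReal.ofReal (t ^ (Real.log k - 1) * (1 - t) ^ (γ - 1)) ∂lam

/-- The operator `Ĥ^{μ,ν}_{p,γ,lam}`:
`Ĥ(a)(m) = (log m)^{μ/p} m^{-1/p} ∑_{n≥2} (log n)^{-ν/p} n^{-1/p'} lam[mn] a_n`,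
where `q = p'` is the conjugate exponent of `p`. -/
noncomputable def carlesonH (p q γ μ ν : ℝ) (lam : Measure ℝ) (a : ℕ → ℂ) :
    ℕ → ℂ := fun m =>
  ((Real.log m ^ (μ / p) / (m : ℝ) ^ (1 / p) : ℝ) : ℂ) *
    ∑' n : ℕ,
      ((Real.log ((n : ℝ) + 2) ^ (-(ν / p)) / ((n : ℝ) + 2) ^ (1 / q) *
          (lamMoment γ lam ((m : ℝ) * ((n : ℝ) + 2))).toReal : ℝ) : ℂ) *
        a (n + 2)

lemma aux_G1 (y z r : ℝ) (hy : 0 < y) (hz : 0 ≤ z) (hr : 0 < r) (hr1 : r < 1) :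
    r * y ^ (r - 1) * (y - z) ≤ y ^ r - z ^ r := by
  have h := rpow_one_add_le_one_add_mul_self (s := z / y - 1) (p := r)
    (by have : 0 ≤ z / y := by positivity
        linarith) hr.le hr1.le
  have e : 1 + (z / y - 1) = z / y := by ring
  rw [e, Real.div_rpow hz hy.le] at h
  have hyr : 0 < y ^ r := by positivity
  rw [div_le_iff₀ hyr] at h
  rw [Real.rpow_sub hy, Real.rpow_one]
  have : r * (y ^ r / y) * (y - z) = y ^ r - (1 + r * (z / y - 1)) * y ^ r := by field_simp; ring
  linarith

lemma aux_G2 (y z r : ℝ) (hy : 0 < y) (hz : 0 < z) (hr : 0 < r) :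
    r * y ^ (-r - 1) * (y - z) ≤ z ^ (-r) - y ^ (-r) := by
  have h : 1 + -r * (z / y - 1) ≤ (z / y) ^ (-r) := by
    have h0 : 0 < z / y := by positivity
    rw [Real.rpow_def_of_pos h0]
    have h1 := Real.add_one_le_exp (Real.log (z / y) * -r)
    have h2 := Real.log_le_sub_one_of_pos h0
    nlinarith
  rw [Real.div_rpow hz.le hy.le] at h
  have hyr : 0 < y ^ (-r) := by positivity
  rw [le_div_iff₀ hyr] at h
  rw [Real.rpow_sub hy, Real.rpow_one]
  have : r * (y ^ (-r) / y) * (y - z) = (1 + -r * (z / y - 1)) * y ^ (-r) - y ^ (-r) := by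
    field_simp; ring
  linarith

/-- concave majorant used for telescoping -/
noncomputable def auxG (a s x y : ℝ) : ℝ :=
  (min y x) ^ (1 - a) * x ^ (-s) / (1 - a)
    + (x ^ (-(a + s - 1)) - (max y x) ^ (-(a + s - 1))) / (a + s - 1)

lemma auxG_step (a s x y z : ℝ) (ha : 0 < a) (ha1 : a < 1) (hs : 0 < s) (has : 1 < a + s)
    (hx : 0 < x) (hz : 0 ≤ z) (hzy : z < y) :
    y ^ (-a) * (x + y) ^ (-s) * (y - z) ≤ auxG a s x y - auxG a s x z := by
  have hy : 0 < y := by linarith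
  have hε : 0 < a + s - 1 := by linarith
  have h1a : 0 < 1 - a := by linarith
  have hbx : (x + y) ^ (-s) ≤ x ^ (-s) :=
    Real.rpow_le_rpow_of_nonpos hx (by linarith) (by linarith)
  have hby : (x + y) ^ (-s) ≤ y ^ (-s) :=
    Real.rpow_le_rpow_of_nonpos hy (by linarith) (by linarith)
  have hya : 0 < y ^ (-a) := by positivity
  have hs0 : 0 < (x + y) ^ (-s) := by positivity
  -- two basic estimates
  have key1 : ∀ w z' : ℝ, 0 < w → 0 ≤ z' →
      w ^ (-a) * x ^ (-s) * (w - z') ≤ (w ^ (1 - a) - z' ^ (1 - a)) * x ^ (-s) / (1 - a) := by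
    intro w z' hw hz'
    have h := aux_G1 w z' (1 - a) hw hz' h1a (by linarith)
    rw [show 1 - a - 1 = -a by ring] at h
    rw [le_div_iff₀ h1a]
    have hxs : 0 < x ^ (-s) := by positivity
    nlinarith
  have key2 : ∀ w z' : ℝ, 0 < w → 0 < z' →
      w ^ (-a) * w ^ (-s) * (w - z')
        ≤ (z' ^ (-(a + s - 1)) - w ^ (-(a + s - 1))) / (a + s - 1) := by
    intro w z' hw hz'
    have h := aux_G2 w z' (a + s - 1) hw hz' hε
    rw [show -(a + s - 1) - 1 = -a + -s by ring, Real.rpow_add hw] at h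
    rw [le_div_iff₀ hε]
    linarith
  unfold auxG
  rcases le_total y x with hyx | hxy
  · rw [min_eq_left hyx, max_eq_right hyx, min_eq_left (by linarith), max_eq_right (by linarith)]
    have := key1 y z hy hz
    have h2 : y ^ (-a) * (x + y) ^ (-s) * (y - z) ≤ y ^ (-a) * x ^ (-s) * (y - z) := by
      have : 0 ≤ y - z := by linarith
      gcongr
    have h3 : (y ^ (1 - a) - z ^ (1 - a)) * x ^ (-s) / (1 - a)
      = y ^ (1 - a) * x ^ (-s) / (1 - a) - z ^ (1 - a) * x ^ (-s) / (1 - a) := by ring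
    linarith
  · rcases le_total x z with hxz | hzx
    · rw [min_eq_right hxy, max_eq_left hxy, min_eq_right hxz, max_eq_left hxz]
      have := key2 y z hy (by linarith)
      have h2 : y ^ (-a) * (x + y) ^ (-s) * (y - z) ≤ y ^ (-a) * y ^ (-s) * (y - z) := by
        have : 0 ≤ y - z := by linarith
        gcongr
      rw [← sub_nonneg] at this ⊢
      rw [← sub_nonneg] at h2
      simp only [sub_div] at *
      linarith
    · rw [min_eq_right hxy, max_eq_left hxy, min_eq_left hzx, max_eq_right hzx]
      have k1 := key1 x z hx hz
      have k2 := key2 y x hy hx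
      have h2 : y ^ (-a) * (x + y) ^ (-s) * (y - x) ≤ y ^ (-a) * y ^ (-s) * (y - x) := by
        have : 0 ≤ y - x := by linarith
        gcongr
      have h3 : y ^ (-a) * (x + y) ^ (-s) * (x - z) ≤ x ^ (-a) * x ^ (-s) * (x - z) := by
        have : 0 ≤ x - z := by linarith
        have : y ^ (-a) ≤ x ^ (-a) := Real.rpow_le_rpow_of_nonpos hx hxy (by linarith)
        gcongr
      simp only [sub_div, sub_mul] at *
      linarith

lemma auxG_le (a s x y : ℝ) (ha1 : a < 1) (has : 1 < a + s)
    (hx : 0 < x) (hy : 0 ≤ y) :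
    auxG a s x y ≤ (1 / (1 - a) + 1 / (a + s - 1)) * x ^ (1 - a - s) := by
  unfold auxG
  have hε : 0 < a + s - 1 := by linarith
  have h1a : 0 < 1 - a := by linarith
  have h1 : (min y x) ^ (1 - a) ≤ x ^ (1 - a) :=
    Real.rpow_le_rpow (le_min hy hx.le) (min_le_right _ _) h1a.le
  have h2 : 0 ≤ (max y x) ^ (-(a + s - 1)) := by positivity
  have h3 : x ^ (1 - a) * x ^ (-s) = x ^ (1 - a - s) := by
    rw [← Real.rpow_add hx]; congr 1
  have h4 : x ^ (-(a + s - 1)) = x ^ (1 - a - s) := by congr 1; ring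
  rw [h4] at *
  have hxs : 0 < x ^ (-s) := by positivity
  calc _ ≤ x ^ (1 - a) * x ^ (-s) / (1 - a) + x ^ (1 - a - s) / (a + s - 1) := by
        gcongr
        linarith
    _ = _ := by rw [h3]; ring

lemma aux_sum (a s : ℝ) (ha : 0 < a) (ha1 : a < 1) (hs : 0 < s) (has : 1 < a + s) :
    ∃ C : ℝ, 0 < C ∧ ∀ x : ℝ, 0 < x →
      ∑' n : ℕ, ENNReal.ofReal (Real.log ((n : ℝ) + 2) ^ (-a) / ((n : ℝ) + 2)
        * (x + Real.log ((n : ℝ) + 2)) ^ (-s)) ≤ ENNReal.ofReal (C * x ^ (1 - a - s)) := by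
  have hε : 0 < a + s - 1 := by linarith
  have h1a : 0 < 1 - a := by linarith
  refine ⟨1 / (1 - a) + 1 / (a + s - 1), by positivity, fun x hx => ?_⟩
  apply ENNReal.tsum_le_of_sum_range_le
  intro N
  have hlog : ∀ n : ℕ, 0 < Real.log ((n : ℝ) + 2) := fun n =>
    Real.log_pos (by have : (0 : ℝ) ≤ n := n.cast_nonneg
                     linarith)
  rw [← ENNReal.ofReal_sum_of_nonneg]
  swap
  · intro n _
    have := hlog n
    positivity
  apply ENNReal.ofReal_le_ofReal
  refine le_trans ?_ (auxG_le a s x (Real.log ((N : ℝ) + 1)) ha1 has hx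
    (Real.log_nonneg (by have : (0 : ℝ) ≤ N := N.cast_nonneg
                         linarith)))
  induction N with
  | zero =>
    simp [auxG, hx.le, h1a.ne', Real.zero_rpow]
  | succ N ih =>
    rw [Finset.sum_range_succ]
    have hN : (0 : ℝ) ≤ N := N.cast_nonneg
    have hz : 0 ≤ Real.log ((N : ℝ) + 1) := Real.log_nonneg (by linarith)
    have hzy : Real.log ((N : ℝ) + 1) < Real.log ((N : ℝ) + 2) :=
      Real.log_lt_log (by linarith) (by linarith)
    have hst := auxG_step a s x (Real.log ((N : ℝ) + 2)) (Real.log ((N : ℝ) + 1)) ha ha1 hs has hx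
      hz hzy
    have hd : 1 / ((N : ℝ) + 2) ≤ Real.log ((N : ℝ) + 2) - Real.log ((N : ℝ) + 1) := by
      have h := Real.log_le_sub_one_of_pos (x := ((N : ℝ) + 1) / ((N : ℝ) + 2)) (by positivity)
      rw [Real.log_div (by positivity) (by positivity)] at h
      have : ((N : ℝ) + 1) / ((N : ℝ) + 2) - 1 = - (1 / ((N : ℝ) + 2)) := by
        field_simp; ring
      linarith
    have hy := hlog N
    have hterm : Real.log ((N : ℝ) + 2) ^ (-a) / ((N : ℝ) + 2)
        * (x + Real.log ((N : ℝ) + 2)) ^ (-s) ≤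
        Real.log ((N : ℝ) + 2) ^ (-a) * (x + Real.log ((N : ℝ) + 2)) ^ (-s)
          * (Real.log ((N : ℝ) + 2) - Real.log ((N : ℝ) + 1)) := by
      rw [show Real.log ((N : ℝ) + 2) ^ (-a) / ((N : ℝ) + 2)
        * (x + Real.log ((N : ℝ) + 2)) ^ (-s) = Real.log ((N : ℝ) + 2) ^ (-a)
          * (x + Real.log ((N : ℝ) + 2)) ^ (-s) * (1 / ((N : ℝ) + 2)) by ring]
      gcongr
    have e : ((N + 1 : ℕ) : ℝ) + 1 = (N : ℝ) + 2 := by push_cast; ring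
    rw [e]
    linarith

lemma aux_schur (p q : ℝ) (hpq : p.HolderConjugate q) (K : ℕ → ℕ → ℝ≥0∞) (u v : ℕ → ℝ≥0∞)
    (A B : ℝ≥0∞) (hu0 : ∀ n, u n ≠ 0) (hu1 : ∀ n, u n ≠ ⊤)
    (h1 : ∀ m, ∑' n, K m n * u n ^ q ≤ A * v m ^ q)
    (h2 : ∀ n, ∑' m, K m n * v m ^ p ≤ B * u n ^ p) (a : ℕ → ℝ≥0∞) :
    ∑' m, (∑' n, K m n * a n) ^ p ≤ A ^ (p / q) * B * ∑' n, a n ^ p := by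
  have hp : 0 < p := hpq.pos
  have hq : 0 < q := hpq.symm.pos
  have hsum : 1 / q + 1 / p = 1 := by
    have := hpq.inv_add_inv_eq_one
    rw [one_div, one_div]; linarith
  have hH : ∀ m, (∑' n, K m n * a n) ^ p ≤
      A ^ (p / q) * v m ^ p * ∑' n, K m n * (a n ^ p * (u n ^ p)⁻¹) := by
    intro m
    have h := ENNReal.lintegral_mul_le_Lp_mul_Lq (Measure.count : Measure ℕ) hpq.symm
      (f := fun n => K m n ^ (1 / q) * u n) (g := fun n => K m n ^ (1 / p) * (a n * (u n)⁻¹))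
      (measurable_of_countable _).aemeasurable (measurable_of_countable _).aemeasurable
    simp only [lintegral_count, Pi.mul_apply] at h
    have e1 : ∀ n, K m n ^ (1 / q) * u n * (K m n ^ (1 / p) * (a n * (u n)⁻¹)) = K m n * a n := by
      intro n
      calc _ = (K m n ^ (1 / q) * K m n ^ (1 / p)) * a n * (u n * (u n)⁻¹) := by ring
        _ = _ := by
          rw [← ENNReal.rpow_add_of_nonneg _ _ (by positivity) (by positivity), hsum,
            ENNReal.rpow_one, ENNReal.mul_inv_cancel (hu0 n) (hu1 n), mul_one]
    have e2 : ∀ n, (K m n ^ (1 / q) * u n) ^ q = K m n * u n ^ q := by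
      intro n
      rw [ENNReal.mul_rpow_of_nonneg _ _ hq.le, ← ENNReal.rpow_mul, one_div_mul_cancel hq.ne',
        ENNReal.rpow_one]
    have e3 : ∀ n, (K m n ^ (1 / p) * (a n * (u n)⁻¹)) ^ p
        = K m n * (a n ^ p * (u n ^ p)⁻¹) := by
      intro n
      rw [ENNReal.mul_rpow_of_nonneg _ _ hp.le, ← ENNReal.rpow_mul, one_div_mul_cancel hp.ne',
        ENNReal.rpow_one, ENNReal.mul_rpow_of_nonneg _ _ hp.le, ENNReal.inv_rpow]
    simp only [e1, e2, e3] at h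
    calc _ ≤ ((∑' n, K m n * u n ^ q) ^ (1 / q) *
          (∑' n, K m n * (a n ^ p * (u n ^ p)⁻¹)) ^ (1 / p)) ^ p := by gcongr
      _ ≤ ((A * v m ^ q) ^ (1 / q) *
          (∑' n, K m n * (a n ^ p * (u n ^ p)⁻¹)) ^ (1 / p)) ^ p := by
          gcongr
          exact h1 m
      _ = _ := by
          rw [ENNReal.mul_rpow_of_nonneg _ _ hp.le, ← ENNReal.rpow_mul, ← ENNReal.rpow_mul,
            one_div_mul_cancel hp.ne', ENNReal.rpow_one,
            ENNReal.mul_rpow_of_nonneg _ _ (by positivity), ← ENNReal.rpow_mul]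
          rw [show 1 / q * p = p / q by ring, show q * (p / q) = p by field_simp]
  calc _ ≤ ∑' m, A ^ (p / q) * v m ^ p * ∑' n, K m n * (a n ^ p * (u n ^ p)⁻¹) :=
        ENNReal.tsum_le_tsum hH
    _ = ∑' m, ∑' n, A ^ (p / q) * (a n ^ p * (u n ^ p)⁻¹) * (K m n * v m ^ p) := by
        congr 1; ext m
        rw [← ENNReal.tsum_mul_left]
        congr 1; ext n; ring
    _ = ∑' n, A ^ (p / q) * (a n ^ p * (u n ^ p)⁻¹) * ∑' m, (K m n * v m ^ p) := by
        rw [ENNReal.tsum_comm]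
        congr 1; ext n
        rw [ENNReal.tsum_mul_left]
    _ ≤ ∑' n, A ^ (p / q) * (a n ^ p * (u n ^ p)⁻¹) * (B * u n ^ p) := by
        gcongr with n
        exact h2 n
    _ = ∑' n, A ^ (p / q) * B * a n ^ p := by
        congr 1; ext n
        calc _ = A ^ (p / q) * B * a n ^ p * (u n ^ p * (u n ^ p)⁻¹) := by ring
          _ = _ := by
            rw [ENNReal.mul_inv_cancel, mul_one]
            · exact (ENNReal.rpow_pos (pos_iff_ne_zero.2 (hu0 n)) (hu1 n)).ne'
            · exact ENNReal.rpow_ne_top_of_nonneg hp.le (hu1 n)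
    _ = _ := by rw [ENNReal.tsum_mul_left]

lemma aux_moment (γ s C₄ : ℝ) (hs : 0 < s) (hs2 : s ≤ 2) (hC₄ : 0 < C₄) (lam : Measure ℝ)
    (hCar : ∀ t ∈ Set.Ico (0 : ℝ) 1,
      (∫⁻ u in Set.Ico t 1, ENNReal.ofReal ((1 - u) ^ (γ - 1)) ∂lam) ≤
        ENNReal.ofReal (C₄ * (1 - t) ^ s)) :
    ∃ D : ℝ, 0 < D ∧ ∀ k : ℝ, 4 ≤ k →
      lamMoment γ lam k ≤ ENNReal.ofReal (D * Real.log k ^ (-s)) := by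
  have hl4 : 1 < Real.log 4 := by
    rw [show (4 : ℝ) = 2 ^ 2 by norm_num, Real.log_pow]
    have := Real.log_two_gt_d9
    push_cast; linarith
  set c : ℝ := 1 - 1 / Real.log 4 with hc
  have hc0 : 0 < c := by
    have : 1 / Real.log 4 < 1 := by rw [div_lt_one (by linarith)]; exact hl4
    linarith
  have hsm : Summable (fun j : ℕ => Real.exp (-c * j) * ((j : ℝ) + 1) ^ s) := by
    have h := (summable_nat_add_iff 1).2 (Real.summable_pow_mul_exp_neg_nat_mul 2 hc0)
    have h' := h.mul_left (Real.exp c)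
    refine Summable.of_nonneg_of_le (fun j => by positivity) (fun j => ?_) h'
    have e : Real.exp c * ((((j + 1 : ℕ) : ℝ)) ^ 2 * Real.exp (-c * ((j + 1 : ℕ) : ℝ)))
        = Real.exp (-c * j) * ((j : ℝ) + 1) ^ 2 := by
      have : Real.exp (-c * j) = Real.exp c * Real.exp (-c * ((j + 1 : ℕ) : ℝ)) := by
        rw [← Real.exp_add]; congr 1; push_cast; ring
      rw [this]; push_cast; ring
    rw [e]
    gcongr
    rw [← Real.rpow_natCast]
    apply Real.rpow_le_rpow_of_exponent_le
    · have : (0 : ℝ) ≤ j := j.cast_nonneg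
      linarith
    · push_cast; exact hs2
  set S : ℝ := ∑' j : ℕ, Real.exp (-c * j) * ((j : ℝ) + 1) ^ s with hS
  have hSpos : 0 < S := hsm.tsum_pos (fun j => by positivity) 0 (by positivity)
  refine ⟨C₄ * S, by positivity, fun k hk => ?_⟩
  set X := Real.log k with hX
  have hX4 : Real.log 4 ≤ X := Real.log_le_log (by norm_num) hk
  have hX0 : 0 < X := by linarith
  have hcX : c * X ≤ X - 1 := by
    rw [hc, sub_mul, one_mul]
    have : 1 ≤ 1 / Real.log 4 * X := by
      rw [div_mul_eq_mul_div, one_mul, le_div_iff₀ (by linarith)]; linarith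
    linarith
  set I : ℕ → Set ℝ := fun j => Set.Ico (max 0 (1 - ((j : ℝ) + 1) / X)) 1 with hI
  set f : ℝ → ℝ≥0∞ := fun u => ENNReal.ofReal ((1 - u) ^ (γ - 1)) with hf
  have hfm : Measurable f := by
    apply Measurable.ennreal_ofReal
    exact (measurable_const.sub measurable_id).pow_const _
  have hpt : ∀ t ∈ Set.Ico (0 : ℝ) 1,
      ENNReal.ofReal (t ^ (Real.log k - 1) * (1 - t) ^ (γ - 1)) ≤
      ∑' j : ℕ, (I j).indicator (fun u => ENNReal.ofReal (Real.exp (-c * j)) * f u) t := by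
    intro t ht
    obtain ⟨ht0, ht1⟩ := ht
    have hy0 : 0 ≤ X * (1 - t) := mul_nonneg hX0.le (by linarith)
    set j := ⌊X * (1 - t)⌋₊ with hj
    have hj1 : (j : ℝ) ≤ X * (1 - t) := Nat.floor_le hy0
    have hj2 : X * (1 - t) < j + 1 := Nat.lt_floor_add_one _
    refine le_trans ?_ (ENNReal.le_tsum j)
    have hmem : t ∈ I j := by
      refine ⟨max_le ht0 ?_, ht1⟩
      have : 1 - t ≤ ((j : ℝ) + 1) / X := by rw [le_div_iff₀ hX0]; linarith
      linarith
    rw [Set.indicator_of_mem hmem, ← ENNReal.ofReal_mul (by positivity)]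
    apply ENNReal.ofReal_le_ofReal
    have h1t : 0 ≤ (1 - t) ^ (γ - 1) := Real.rpow_nonneg (by linarith) _
    gcongr
    rcases ht0.eq_or_lt with h0 | h0
    · rw [← h0, Real.zero_rpow (by linarith)]; positivity
    · rw [Real.rpow_def_of_pos h0, Real.exp_le_exp]
      have h1 := Real.log_le_sub_one_of_pos h0
      have h2 : Real.log t * (X - 1) ≤ (t - 1) * (X - 1) :=
        mul_le_mul_of_nonneg_right h1 (by linarith)
      have h3 : (c * X) * (1 - t) ≤ (X - 1) * (1 - t) :=
        mul_le_mul_of_nonneg_right hcX (by linarith)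
      have h4 : c * j ≤ c * (X * (1 - t)) := mul_le_mul_of_nonneg_left hj1 hc0.le
      linarith
  have hint : ∀ j : ℕ, ∫⁻ t, (I j).indicator
      (fun u => ENNReal.ofReal (Real.exp (-c * j)) * f u) t ∂lam ≤
      ENNReal.ofReal (C₄ * X ^ (-s) * (Real.exp (-c * j) * ((j : ℝ) + 1) ^ s)) := by
    intro j
    rw [lintegral_indicator measurableSet_Ico, lintegral_const_mul _ hfm]
    have hw : 0 < ((j : ℝ) + 1) / X := by positivity
    have h := hCar (max 0 (1 - ((j : ℝ) + 1) / X)) ⟨le_max_left _ _, by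
      apply max_lt <;> linarith⟩
    calc _ ≤ ENNReal.ofReal (Real.exp (-c * j)) *
          ENNReal.ofReal (C₄ * (1 - max 0 (1 - ((j : ℝ) + 1) / X)) ^ s) := by gcongr
      _ ≤ ENNReal.ofReal (Real.exp (-c * j)) *
          ENNReal.ofReal (C₄ * (((j : ℝ) + 1) / X) ^ s) := by
          gcongr
          · have : max 0 (1 - ((j : ℝ) + 1) / X) ≤ 1 := by apply max_le <;> linarith
            linarith
          · have := le_max_right 0 (1 - ((j : ℝ) + 1) / X)
            linarith
      _ = _ := by
          rw [← ENNReal.ofReal_mul (by positivity), Real.div_rpow (by positivity) hX0.le,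
            Real.rpow_neg hX0.le]
          congr 1
          field_simp
  calc lamMoment γ lam k ≤ ∫⁻ t in Set.Ico (0 : ℝ) 1, ∑' j : ℕ, (I j).indicator
        (fun u => ENNReal.ofReal (Real.exp (-c * j)) * f u) t ∂lam :=
        setLIntegral_mono' measurableSet_Ico hpt
    _ ≤ ∫⁻ t, ∑' j : ℕ, (I j).indicator
        (fun u => ENNReal.ofReal (Real.exp (-c * j)) * f u) t ∂lam := setLIntegral_le_lintegral _ _
    _ = ∑' j : ℕ, ∫⁻ t, (I j).indicator
        (fun u => ENNReal.ofReal (Real.exp (-c * j)) * f u) t ∂lam := by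
        apply lintegral_tsum
        intro j
        exact ((hfm.const_mul _).indicator measurableSet_Ico).aemeasurable
    _ ≤ ∑' j : ℕ, ENNReal.ofReal (C₄ * X ^ (-s) * (Real.exp (-c * j) * ((j : ℝ) + 1) ^ s)) :=
        ENNReal.tsum_le_tsum hint
    _ = _ := by
        rw [← ENNReal.ofReal_tsum_of_nonneg (fun j => by positivity) (hsm.mul_left _),
          tsum_mul_left]
        congr 1
        ring

/-- **(Proposition 4.3.)** Let `p > 1`, `γ > 0`, `−1 < μ, ν < p−1`, and let `lam` be a
positive Borel measure on `[0,1)`. If the measure `τ` with `dτ(t) = (1−t)^{γ−1} dlam(t)`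
is a `[1+(μ−ν)/p]`-Carleson measure, then `Ĥ^{μ,ν}_{p,γ,lam}` is bounded on `l^p`. -/
theorem carlesonH_bounded (p q γ μ ν C₄ : ℝ) (hp : 1 < p) (hq : 1 / p + 1 / q = 1)
    (hγ : 0 < γ) (hμ1 : -1 < μ) (hμ2 : μ < p - 1) (hν1 : -1 < ν) (hν2 : ν < p - 1)
    (hC₄ : 0 < C₄) (lam : Measure ℝ) (hlam : lam (Set.Ico (0 : ℝ) 1)ᶜ = 0)
    (hCar : ∀ t ∈ Set.Ico (0 : ℝ) 1,
      (∫⁻ u in Set.Ico t 1, ENNReal.ofReal ((1 - u) ^ (γ - 1)) ∂lam) ≤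
        ENNReal.ofReal (C₄ * (1 - t) ^ (1 + (μ - ν) / p))) :
    ∃ C : ℝ, 0 < C ∧ ∀ a : ℕ → ℂ, lpNorm p a ≠ ⊤ →
      lpNorm p (carlesonH p q γ μ ν lam a) ≤ ENNReal.ofReal C * lpNorm p a := by
  have hp0 : 0 < p := by linarith
  have hqe : 1 / q = 1 - 1 / p := by linarith
  have hp1 : 1 / p < 1 := by rw [div_lt_one hp0]; exact hp
  have hq0 : 0 < q := by
    have : 0 < 1 / q := by linarith
    exact one_div_pos.1 this
  have hpq : p.HolderConjugate q := Real.holderConjugate_iff.mpr ⟨hp, by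
    rw [← one_div, ← one_div]; exact hq⟩
  have hpp : 1 / p * p = 1 := one_div_mul_cancel hp0.ne'
  have hi : 0 < 1 / p := by positivity
  set s : ℝ := 1 + (μ - ν) / p with hs
  have hμp : μ / p = μ * (1 / p) := by ring
  have hνp : ν / p = ν * (1 / p) := by ring
  have hsp : s = 1 + μ * (1 / p) - ν * (1 / p) := by rw [hs]; ring
  have hs0 : 0 < s := by rw [hsp]; nlinarith
  have hs2 : s ≤ 2 := by rw [hsp]; nlinarith
  obtain ⟨D, hD, hmom⟩ := aux_moment γ s C₄ hs0 hs2 hC₄ lam hCar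
  obtain ⟨C1, hC1, hsum1⟩ := aux_sum (ν / p + 1 / p) s (by rw [hνp]; nlinarith)
    (by rw [hνp]; nlinarith) hs0 (by rw [hνp, hsp]; nlinarith)
  obtain ⟨C2, hC2, hsum2⟩ := aux_sum (1 / q - μ / p) s (by rw [hμp, hqe]; nlinarith)
    (by rw [hμp, hqe]; nlinarith) hs0 (by rw [hμp, hqe, hsp]; nlinarith)
  set L : ℕ → ℝ := fun n => Real.log ((n : ℝ) + 2) with hL
  have hLpos : ∀ n, 0 < L n := fun n =>
    Real.log_pos (by have : (0 : ℝ) ≤ n := n.cast_nonneg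
                     linarith)
  set N : ℕ → ℝ := fun n => (n : ℝ) + 2 with hN
  have hNpos : ∀ n, 0 < N n := fun n => by simp only [hN]; positivity
  set K : ℕ → ℕ → ℝ≥0∞ := fun m n => ENNReal.ofReal
    (D * (L m ^ (μ / p) / N m ^ (1 / p) * (L n ^ (-(ν / p)) / N n ^ (1 / q))
      * (L m + L n) ^ (-s))) with hK
  set u : ℕ → ℝ≥0∞ := fun n => ENNReal.ofReal ((N n * L n) ^ (-(1 / (p * q)))) with hu
  have huq : ∀ n, u n ^ q = ENNReal.ofReal (N n ^ (-(1 / p)) * L n ^ (-(1 / p))) := by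
    intro n
    have h1 := hLpos n
    have h2 := hNpos n
    simp only [hu]
    rw [ENNReal.ofReal_rpow_of_nonneg (by positivity) hq0.le, ← Real.rpow_mul (by positivity),
      show -(1 / (p * q)) * q = -(1 / p) by field_simp, Real.mul_rpow h2.le h1.le]
  have hup : ∀ n, u n ^ p = ENNReal.ofReal (N n ^ (-(1 / q)) * L n ^ (-(1 / q))) := by
    intro n
    have h1 := hLpos n
    have h2 := hNpos n
    simp only [hu]
    rw [ENNReal.ofReal_rpow_of_nonneg (by positivity) hp0.le, ← Real.rpow_mul (by positivity),
      show -(1 / (p * q)) * p = -(1 / q) by field_simp, Real.mul_rpow h2.le h1.le]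
  have hNinv : ∀ n, N n ^ (-(1 / p)) * N n ^ (-(1 / q)) = (N n)⁻¹ := by
    intro n
    rw [← Real.rpow_add (hNpos n), show -(1 / p) + -(1 / q) = -1 by linarith, Real.rpow_neg_one]
  have hrow : ∀ m, ∑' n, K m n * u n ^ q ≤ ENNReal.ofReal (D * C1) * u m ^ q := by
    intro m
    have hm1 := hLpos m
    have hm2 := hNpos m
    have e : ∀ n, K m n * u n ^ q = ENNReal.ofReal (D * L m ^ (μ / p) * N m ^ (-(1 / p))) *
        ENNReal.ofReal (Real.log ((n : ℝ) + 2) ^ (-(ν / p + 1 / p)) / ((n : ℝ) + 2)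
        * (L m + Real.log ((n : ℝ) + 2)) ^ (-s)) := by
      intro n
      have h1 := hLpos n
      have h2 := hNpos n
      change K m n * u n ^ q = ENNReal.ofReal (D * L m ^ (μ / p) * N m ^ (-(1 / p))) *
        ENNReal.ofReal (L n ^ (-(ν / p + 1 / p)) / N n * (L m + L n) ^ (-s))
      rw [huq]
      simp only [hK]
      rw [← ENNReal.ofReal_mul (by positivity), ← ENNReal.ofReal_mul (by positivity)]
      congr 1
      rw [div_eq_mul_inv _ (N n), ← hNinv n, show -(ν / p + 1 / p) = -(ν / p) + -(1 / p) by ring,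
        Real.rpow_add h1, div_eq_mul_inv _ (N m ^ (1 / p)), ← Real.rpow_neg hm2.le,
        div_eq_mul_inv _ (N n ^ (1 / q)), ← Real.rpow_neg h2.le]
      ring
    simp only [e]
    rw [ENNReal.tsum_mul_left, huq]
    refine (mul_le_mul_right (hsum1 (L m) hm1) _).trans (le_of_eq ?_)
    rw [← ENNReal.ofReal_mul (by positivity), ← ENNReal.ofReal_mul (by positivity)]
    congr 1
    have : L m ^ (μ / p) * L m ^ (1 - (ν / p + 1 / p) - s) = L m ^ (-(1 / p)) := by
      rw [← Real.rpow_add hm1]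
      congr 1
      rw [hsp]; ring
    rw [← this]; ring
  have hcol : ∀ n, ∑' m, K m n * u m ^ p ≤ ENNReal.ofReal (D * C2) * u n ^ p := by
    intro n
    have h1 := hLpos n
    have h2 := hNpos n
    have e : ∀ m, K m n * u m ^ p = ENNReal.ofReal (D * L n ^ (-(ν / p)) * N n ^ (-(1 / q))) *
        ENNReal.ofReal (Real.log ((m : ℝ) + 2) ^ (-(1 / q - μ / p)) / ((m : ℝ) + 2)
        * (L n + Real.log ((m : ℝ) + 2)) ^ (-s)) := by
      intro m
      have hm1 := hLpos m
      have hm2 := hNpos m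
      change K m n * u m ^ p = ENNReal.ofReal (D * L n ^ (-(ν / p)) * N n ^ (-(1 / q))) *
        ENNReal.ofReal (L m ^ (-(1 / q - μ / p)) / N m * (L n + L m) ^ (-s))
      rw [hup]
      simp only [hK]
      rw [← ENNReal.ofReal_mul (by positivity), ← ENNReal.ofReal_mul (by positivity)]
      congr 1
      rw [div_eq_mul_inv _ (N m), ← hNinv m, show -(1 / q - μ / p) = μ / p + -(1 / q) by ring,
        Real.rpow_add hm1, div_eq_mul_inv _ (N m ^ (1 / p)), ← Real.rpow_neg hm2.le,
        div_eq_mul_inv _ (N n ^ (1 / q)), ← Real.rpow_neg h2.le, add_comm (L n)]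
      ring
    simp only [e]
    rw [ENNReal.tsum_mul_left, hup]
    refine (mul_le_mul_right (hsum2 (L n) h1) _).trans (le_of_eq ?_)
    rw [← ENNReal.ofReal_mul (by positivity), ← ENNReal.ofReal_mul (by positivity)]
    congr 1
    have : L n ^ (-(ν / p)) * L n ^ (1 - (1 / q - μ / p) - s) = L n ^ (-(1 / q)) := by
      rw [← Real.rpow_add h1]
      congr 1
      rw [hsp]; ring
    rw [← this]; ring
  have hschur := aux_schur p q hpq K u u (ENNReal.ofReal (D * C1)) (ENNReal.ofReal (D * C2))
    (fun n => by
      have h1 := hLpos n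
      have h2 := hNpos n
      simp only [hu, ne_eq, ENNReal.ofReal_eq_zero, not_le]
      positivity) (fun n => ENNReal.ofReal_ne_top) hrow hcol
  refine ⟨((D * C1) ^ (p / q) * (D * C2)) ^ (1 / p), by positivity, fun a _ => ?_⟩
  have hpt : ∀ m, ((‖carlesonH p q γ μ ν lam a (m + 2)‖₊ : ℝ≥0∞)) ≤
      ∑' n, K m n * (‖a (n + 2)‖₊ : ℝ≥0∞) := by
    intro m
    have hm1 := hLpos m
    have hm2 := hNpos m
    change ‖carlesonH p q γ μ ν lam a (m + 2)‖ₑ ≤ ∑' n, K m n * ‖a (n + 2)‖ₑ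
    unfold carlesonH
    rw [enorm_mul]
    refine (mul_le_mul_right enorm_tsum_le_tsum_enorm _).trans ?_
    rw [← ENNReal.tsum_mul_left]
    refine ENNReal.tsum_le_tsum fun n => ?_
    have h1 := hLpos n
    have h2 := hNpos n
    rw [enorm_mul, ← mul_assoc]
    refine mul_le_mul_left ?_ _
    have hcast : ((m + 2 : ℕ) : ℝ) = N m := by simp [hN]
    rw [hcast]
    change ‖((L m ^ (μ / p) / N m ^ (1 / p) : ℝ) : ℂ)‖ₑ *
      ‖((L n ^ (-(ν / p)) / N n ^ (1 / q) * (lamMoment γ lam (N m * N n)).toReal : ℝ) : ℂ)‖ₑ ≤ _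
    have hNN : 4 ≤ N m * N n := by
      have a1 : (2 : ℝ) ≤ N m := by simp [hN]
      have a2 : (2 : ℝ) ≤ N n := by simp [hN]
      nlinarith
    have hmo := hmom (N m * N n) hNN
    rw [Real.log_mul hm2.ne' h2.ne'] at hmo
    change lamMoment γ lam (N m * N n) ≤ ENNReal.ofReal (D * (L m + L n) ^ (-s)) at hmo
    have hmoR : (lamMoment γ lam (N m * N n)).toReal ≤ D * (L m + L n) ^ (-s) :=
      ENNReal.toReal_le_of_le_ofReal (by positivity) hmo
    rw [← enorm_mul, ← Complex.ofReal_mul, ← ofReal_norm, Complex.norm_real,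
      Real.norm_of_nonneg (by positivity)]
    simp only [hK]
    apply ENNReal.ofReal_le_ofReal
    calc _ ≤ L m ^ (μ / p) / N m ^ (1 / p) * (L n ^ (-(ν / p)) / N n ^ (1 / q) *
          (D * (L m + L n) ^ (-s))) := by gcongr
      _ = _ := by ring
  unfold _root_.lpNorm
  calc _ ≤ (∑' m, (∑' n, K m n * (‖a (n + 2)‖₊ : ℝ≥0∞)) ^ p) ^ (1 / p) := by
        gcongr with m
        exact hpt m
    _ ≤ (ENNReal.ofReal (D * C1) ^ (p / q) * ENNReal.ofReal (D * C2) *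
          ∑' n, (‖a (n + 2)‖₊ : ℝ≥0∞) ^ p) ^ (1 / p) := by
        gcongr
        exact hschur _
    _ = _ := by
        rw [ENNReal.mul_rpow_of_nonneg _ _ hi.le,
          ENNReal.ofReal_rpow_of_nonneg (by positivity) (by positivity),
          ← ENNReal.ofReal_mul (by positivity),
          ENNReal.ofReal_rpow_of_nonneg (by positivity) hi.le]
end
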